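/- Let (Θ, μ) be a probability space and s : Θ × ℝ^M → ℝ a family of scalarisation functions such that for every y ∈ ℝ^M the map θ ↦ s(θ, y) is integrable with respect to μ, and such that for every θ ∈ Θ the function y ↦ s(θ, y) is monotonically increasing, i.e. y ⪰ y' implies s(θ, y) ≥ s(θ, y'). Define the R2 utility U(Y) = ∫_Θ max_{y ∈ Y} s(θ, y) dμ(θ) on nonempty finite subsets of ℝ^M. Then U is weakly Pareto compliant: for all nonempty finite sets A, B ⊆ ℝ^M, if every b ∈ B is weakly Pareto dominated by some a ∈ A, then U(A) ≥ U(B). -/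

import Mathlib

open MeasureTheory

/-- The pointwise maximum of a nonempty finite family of integrable functions is integrable. -/
theorem integrable_finset_sup' {ι Θ : Type*} [MeasurableSpace Θ] {μ : Measure Θ}
    {f : Θ → ι → ℝ} {t : Finset ι} (ht : t.Nonempty)
    (hf : ∀ i ∈ t, Integrable (fun θ => f θ i) μ) :
    Integrable (fun θ => t.sup' ht (f θ)) μ := by
  have h := Finset.sup'_induction (p := fun g : Θ → ℝ => Integrable g μ) ht
    (fun i θ => f θ i) (fun _ h₁ _ h₂ => h₁.sup h₂) hf
  convert h using 1
  ext θ
  rw [Finset.sup'_apply]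

/-- If each scalarisation `s θ` is monotonically increasing with respect to
weak Pareto domination, then the R2 utility is weakly Pareto compliant. -/
theorem r2_utility_weakly_pareto_compliant
    {M : ℕ} {Θ : Type*} [MeasurableSpace Θ] (μ : Measure Θ) [IsProbabilityMeasure μ]
    (s : Θ → (Fin M → ℝ) → ℝ)
    (hint : ∀ y : Fin M → ℝ, Integrable (fun θ => s θ y) μ)
    (hmono : ∀ θ : Θ, ∀ y y' : Fin M → ℝ, (∀ m, y' m ≤ y m) → s θ y' ≤ s θ y)
    (A B : Finset (Fin M → ℝ)) (hA : A.Nonempty) (hB : B.Nonempty)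
    (hdom : ∀ b ∈ B, ∃ a ∈ A, ∀ m, b m ≤ a m) :
    (∫ θ, B.sup' hB (s θ) ∂μ) ≤ (∫ θ, A.sup' hA (s θ) ∂μ) := by
  refine integral_mono (integrable_finset_sup' hB fun y _ => hint y)
    (integrable_finset_sup' hA fun y _ => hint y) fun θ => Finset.sup'_le hB _ fun b hb => ?_
  obtain ⟨a, ha, hab⟩ := hdom b hb
  exact (hmono θ a b hab).trans (Finset.le_sup' (s θ) ha)
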